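/- arXiv:2305.03215 — 3 statements merged into one kernel-verified Lean document; each statement's English description precedes it below -/
import Mathlib

section
/- Let (M,d) be a proper geodesic metric space and L > 0. Let Φ : M → ℝ be geodesically convex and L-Lipschitz, and assume its set of minimizers M* = {x ∈ M : Φ(x) = inf_M Φ} is non-empty and bounded. Let (f_n)_{n≥1} be geodesically convex, L-Lipschitz functions on M converging pointwise to Φ, and for each n let x_n ∈ M be a minimizer of f_n over M. Then d(x_n, M*) → 0 as n → ∞, where d(x,S) = inf_{y∈S} d(x,y). -/
open MeasureTheory Filter Topology

/-- A unit-speed geodesic from `x` to `y` (parametrized on `[0,1]`). -/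
def IsUnitSpeedGeodesic {M : Type*} [MetricSpace M] (γ : ℝ → M) (x y : M) : Prop :=
  ContinuousOn γ (Set.Icc 0 1) ∧ γ 0 = x ∧ γ 1 = y ∧
    ∀ s ∈ Set.Icc (0:ℝ) 1, ∀ t ∈ Set.Icc (0:ℝ) 1,
      dist (γ s) (γ t) = |s - t| * dist x y

/-- A geodesic space: every pair of points is joined by a unit-speed geodesic. -/
def GeodesicSpace (M : Type*) [MetricSpace M] : Prop :=
  ∀ x y : M, ∃ γ : ℝ → M, IsUnitSpeedGeodesic γ x y

/-- Geodesic convexity of a real-valued function. -/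
def GeodesicallyConvex {M : Type*} [MetricSpace M] (f : M → ℝ) : Prop :=
  ∀ x y : M, ∀ γ : ℝ → M, IsUnitSpeedGeodesic γ x y →
    ∀ t ∈ Set.Icc (0:ℝ) 1, f (γ t) ≤ (1 - t) * f x + t * f y

/-- Deterministic consistency: minimizers of pointwise-converging
convex equi-Lipschitz functions converge to the minimizing set of the limit. -/
theorem stmt3 {M : Type*} [MetricSpace M] [ProperSpace M] (hgeo : GeodesicSpace M)
    (L : ℝ) (hL : 0 < L) (Φ : M → ℝ)
    (hΦconv : GeodesicallyConvex Φ)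
    (hΦlip : ∀ x y : M, |Φ x - Φ y| ≤ L * dist x y)
    (Mstar : Set M) (hMstar : Mstar = {x : M | ∀ y : M, Φ x ≤ Φ y})
    (hne : Mstar.Nonempty) (hbdd : Bornology.IsBounded Mstar)
    (f : ℕ → M → ℝ)
    (hconv : ∀ n, GeodesicallyConvex (f n))
    (hlip : ∀ n, ∀ x y : M, |f n x - f n y| ≤ L * dist x y)
    (hpt : ∀ x : M, Tendsto (fun n => f n x) atTop (𝓝 (Φ x)))
    (xn : ℕ → M) (hxn : ∀ n, ∀ y : M, f n (xn n) ≤ f n y) :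
    Tendsto (fun n => Metric.infDist (xn n) Mstar) atTop (𝓝 0) := by
  have hmin : ∀ x, x ∈ Mstar ↔ ∀ y, Φ x ≤ Φ y := fun x => by rw [hMstar]; rfl
  obtain ⟨y₀, hy₀⟩ := hne
  rw [Metric.tendsto_atTop']
  by_contra! hfar
  obtain ⟨ε, hε, hfar⟩ := hfar
  -- geodesics to far minimizers cross the level set `infDist = ε`, where `f n ≤ f n y₀`
  have hcross : ∀ N, ∃ n > N, ∃ z, Metric.infDist z Mstar = ε ∧ f n z ≤ f n y₀ := by
    intro N
    obtain ⟨n, hn, hdist⟩ := hfar N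
    rw [Real.dist_eq, sub_zero, abs_of_nonneg Metric.infDist_nonneg] at hdist
    obtain ⟨γ, hγ⟩ := hgeo y₀ (xn n)
    obtain ⟨hcont, h0, h1, -⟩ := id hγ
    have hg : ContinuousOn (fun t => Metric.infDist (γ t) Mstar) (Set.Icc 0 1) :=
      (Metric.continuous_infDist_pt Mstar).comp_continuousOn hcont
    obtain ⟨t, ht, hteq⟩ := intermediate_value_Icc zero_le_one hg
      (show ε ∈ Set.Icc _ _ by
        simpa only [h0, h1, Metric.infDist_zero_of_mem hy₀] using ⟨hε.le, hdist⟩)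
    refine ⟨n, hn, γ t, hteq, ?_⟩
    have h := hconv n y₀ (xn n) γ hγ t ht
    have h' := mul_le_mul_of_nonneg_left (hxn n y₀) ht.1
    linarith
  obtain ⟨φ, hφ, hφz⟩ := extraction_of_frequently_atTop
    (P := fun n => ∃ z, Metric.infDist z Mstar = ε ∧ f n z ≤ f n y₀)
    (frequently_atTop'.2 hcross)
  choose z hzdist hzle using hφz
  have hK : IsCompact (Metric.cthickening ε Mstar) :=
    Metric.isCompact_of_isClosed_isBounded Metric.isClosed_cthickening hbdd.cthickening
  have hzK : ∀ k, z k ∈ Metric.cthickening ε Mstar := fun k => by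
    rw [Metric.mem_cthickening_iff,
      ENNReal.le_ofReal_iff_toReal_le (Metric.infEDist_ne_top ⟨y₀, hy₀⟩) hε.le]
    exact (hzdist k).le
  obtain ⟨w, -, ψ, hψ, hlim⟩ := hK.tendsto_subseq hzK
  have hwdist : Metric.infDist w Mstar = ε := by
    refine tendsto_nhds_unique
      (((Metric.continuous_infDist_pt Mstar).tendsto w).comp hlim) ?_
    simpa only [Function.comp_def, hzdist] using tendsto_const_nhds
  have hsub : Tendsto (fun k => φ (ψ k)) atTop atTop :=
    hφ.tendsto_atTop.comp hψ.tendsto_atTop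
  have hle : Φ w ≤ Φ y₀ := by
    have hd : Tendsto (fun k => L * dist w (z (ψ k))) atTop (𝓝 0) := by
      simpa using ((tendsto_const_nhds (x := w)).dist hlim).const_mul L
    have hr := ((hpt y₀).comp hsub).add hd
    rw [add_zero] at hr
    refine le_of_tendsto_of_tendsto' ((hpt w).comp hsub) hr fun k => ?_
    have h1 := (abs_le.1 (hlip (φ (ψ k)) w (z (ψ k)))).2
    have h2 := hzle (ψ k)
    simp only [Function.comp_apply]
    linarith
  have hw : w ∈ Mstar := (hmin w).2 fun y => hle.trans ((hmin y₀).1 hy₀ y)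
  exact hε.ne (Metric.infDist_zero_of_mem hw ▸ hwdist)
end

section
/- Let (M,d) be a geodesic metric space, f : M → ℝ a geodesically convex function, S ⊆ M a non-empty subset, x* ∈ S, and ε > 0. Suppose that f(x) > f(x*) for every x ∈ M with d(x,S) = ε, where d(x,S) = inf_{y∈S} d(x,y). Then every minimizer y of f over M satisfies d(y,S) ≤ ε. -/
open MeasureTheory Filter Topology

/-- If a geodesically convex function exceeds its value at a point
`x* ∈ S` everywhere on the "sphere" `{x : d(x,S) = ε}`, then every global
minimizer lies within distance `ε` of `S`. -/
theorem stmt7 {M : Type*} [MetricSpace M] (hgeo : GeodesicSpace M)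
    (f : M → ℝ) (hconv : GeodesicallyConvex f)
    (S : Set M) (xstar : M) (hxstar : xstar ∈ S)
    (ε : ℝ) (hε : 0 < ε)
    (hgt : ∀ x : M, Metric.infDist x S = ε → f xstar < f x)
    (y : M) (hy : ∀ z : M, f y ≤ f z) :
    Metric.infDist y S ≤ ε := by
  by_contra! hlt
  obtain ⟨γ, hγ⟩ := hgeo xstar y
  obtain ⟨hcont, h0, h1, -⟩ := id hγ
  have hdist : ContinuousOn (fun t => Metric.infDist (γ t) S) (Set.Icc 0 1) :=
    (Metric.continuous_infDist_pt S).comp_continuousOn hcont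
  have hmem : ε ∈ Set.Icc (Metric.infDist (γ 0) S) (Metric.infDist (γ 1) S) := by
    rw [h0, h1, Metric.infDist_zero_of_mem hxstar]
    exact ⟨hε.le, hlt.le⟩
  obtain ⟨t, ht, hεt⟩ := intermediate_value_Icc zero_le_one hdist hmem
  have hle := hconv xstar y γ hγ t ht
  have hstar := hgt (γ t) hεt
  nlinarith [mul_le_mul_of_nonneg_left (hy xstar) ht.1]
end

section
/- Let (𝒵,ℱ,P) be a probability space and E a Polish space. Let Γ be a map assigning to every z ∈ 𝒵 a closed subset Γ(z) ⊆ E. Assume there exists N ∈ ℱ with P(N) = 0 such that Γ(z) ≠ ∅ for all z ∈ 𝒵 \ N, and that for every open subset U ⊆ E the set {z ∈ 𝒵 \ N : Γ(z) ∩ U ≠ ∅} belongs to ℱ. Then there exists a measurable function g : 𝒵 → E such that g(z) ∈ Γ(z) for P-almost all z ∈ 𝒵. -/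
open MeasureTheory

open Set in
/-- Refinement step for measurable selections: if `Γ z` meets `V (k z)` for a measurable index `k`,
and the open sets `W m` cover the space, then `W m` can be chosen measurably so that
`Γ z` meets `V (k z) ∩ W m`. -/
theorem exists_measurable_nat_inter_nonempty {𝒵 E : Type*} [MeasurableSpace 𝒵] [TopologicalSpace E]
    {Γ : 𝒵 → Set E} (hweak : ∀ U : Set E, IsOpen U → MeasurableSet {z | (Γ z ∩ U).Nonempty})
    {V W : ℕ → Set E} (hV : ∀ j, IsOpen (V j)) (hW : ∀ m, IsOpen (W m)) (hcover : ⋃ m, W m = univ)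
    {k : 𝒵 → ℕ} (hk : Measurable k) (hne : ∀ z, (Γ z ∩ V (k z)).Nonempty) :
    ∃ k' : 𝒵 → ℕ, Measurable k' ∧ ∀ z, (Γ z ∩ (V (k z) ∩ W (k' z))).Nonempty := by
  classical
  have hex : ∀ z, ∃ m, (Γ z ∩ (V (k z) ∩ W m)).Nonempty := by
    intro z
    obtain ⟨x, hxΓ, hxV⟩ := hne z
    obtain ⟨m, hm⟩ := mem_iUnion.1 (hcover ▸ mem_univ x)
    exact ⟨m, x, hxΓ, hxV, hm⟩
  refine ⟨fun z ↦ Nat.find (hex z), measurable_find hex fun m ↦ ?_, fun z ↦ Nat.find_spec (hex z)⟩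
  have heq : {z | (Γ z ∩ (V (k z) ∩ W m)).Nonempty} =
      ⋃ j, k ⁻¹' {j} ∩ {z | (Γ z ∩ (V j ∩ W m)).Nonempty} := by
    ext z
    simp
  rw [heq]
  exact .iUnion fun j ↦ (hk (measurableSet_singleton j)).inter (hweak _ ((hV j).inter (hW m)))

open Set Filter Topology Metric in
/-- The **Kuratowski–Ryll-Nardzewski measurable selection theorem**. -/
theorem exists_measurable_selection {𝒵 E : Type*} [MeasurableSpace 𝒵] [TopologicalSpace E]
    [PolishSpace E] [MeasurableSpace E] [BorelSpace E] [Nonempty E]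
    {Γ : 𝒵 → Set E} (hclosed : ∀ z, IsClosed (Γ z)) (hne : ∀ z, (Γ z).Nonempty)
    (hweak : ∀ U : Set E, IsOpen U → MeasurableSet {z | (Γ z ∩ U).Nonempty}) :
    ∃ g : 𝒵 → E, Measurable g ∧ ∀ z, g z ∈ Γ z := by
  let := TopologicalSpace.upgradeIsCompletelyMetrizable E
  let d := TopologicalSpace.denseSeq E
  let B : ℕ → ℕ → Set E := fun n j ↦ ball (d j) ((1 / 2) ^ n)
  have hBo : ∀ n j, IsOpen (B n j) := fun _ _ ↦ isOpen_ball
  have hBc : ∀ n, ⋃ j, B n j = univ := fun n ↦ eq_univ_of_forall fun x ↦ by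
    obtain ⟨j, hj⟩ :=
      (TopologicalSpace.denseRange_denseSeq E).exists_dist_lt x (by positivity : (0 : ℝ) < (1 / 2) ^ n)
    exact mem_iUnion.2 ⟨j, hj⟩
  let Q : ℕ → (𝒵 → ℕ) → Prop := fun n k ↦ Measurable k ∧ ∀ z, (Γ z ∩ B n (k z)).Nonempty
  obtain ⟨k₀, hk₀, hk₀Γ⟩ : ∃ k, Q 0 k := by
    obtain ⟨k, hk, hkΓ⟩ := exists_measurable_nat_inter_nonempty hweak
      (V := fun _ ↦ univ) (fun _ ↦ isOpen_univ) (hBo 0) (hBc 0) (measurable_const (a := 0))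
      (by simpa using hne)
    exact ⟨k, hk, by simpa using hkΓ⟩
  have hstep : ∀ n (k : {k // Q n k}), ∃ k' : {k' // Q (n + 1) k'},
      ∀ z, (Γ z ∩ (B n (k.1 z) ∩ B (n + 1) (k'.1 z))).Nonempty := by
    rintro n ⟨k, hk, hkΓ⟩
    obtain ⟨k', hk', hk'Γ⟩ := exists_measurable_nat_inter_nonempty hweak
      (hBo n) (hBo (n + 1)) (hBc (n + 1)) hk hkΓ
    exact ⟨⟨k', hk', fun z ↦ (hk'Γ z).mono (inter_subset_inter_right _ inter_subset_right)⟩, hk'Γ⟩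
  choose next hnext using hstep
  let s : ∀ n, {k // Q n k} := fun n ↦ Nat.rec ⟨k₀, hk₀, hk₀Γ⟩ next n
  let u : ℕ → 𝒵 → E := fun n z ↦ d ((s n).1 z)
  have hdist : ∀ z n, dist (u n z) (u (n + 1) z) ≤ 2 * (1 / 2) ^ n := by
    intro z n
    obtain ⟨x, -, hx, hx'⟩ := hnext n (s n) z
    have h₁ : dist x (u n z) < (1 / 2) ^ n := hx
    have h₂ : dist x (u (n + 1) z) < (1 / 2) ^ (n + 1) := hx'
    have h₃ := dist_triangle_left (u n z) (u (n + 1) z) x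
    have h₄ : (0 : ℝ) < (1 / 2) ^ n := by positivity
    rw [pow_succ] at h₂
    linarith
  have hlim : ∀ z, ∃ y, Tendsto (fun n ↦ u n z) atTop (𝓝 y) := fun z ↦
    cauchySeq_tendsto_of_complete
      (cauchySeq_of_le_geometric (1 / 2) 2 (by norm_num) (hdist z))
  choose g hg using hlim
  refine ⟨g, measurable_of_tendsto_metrizable
    (fun n ↦ measurable_from_nat.comp (s n).2.1) (tendsto_pi_nhds.2 hg), fun z ↦ ?_⟩
  choose x hxΓ hx using fun n ↦ (s n).2.2 z
  have hxu : Tendsto (fun n ↦ dist (u n z) (x n)) atTop (𝓝 0) := by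
    refine squeeze_zero (fun _ ↦ dist_nonneg) (fun n ↦ ?_)
      (tendsto_pow_atTop_nhds_zero_of_lt_one (r := (1 / 2 : ℝ)) (by norm_num) (by norm_num))
    rw [dist_comm]
    exact (mem_ball.1 (hx n)).le
  exact (hclosed z).mem_of_tendsto ((tendsto_iff_of_dist hxu).1 (hg z)) (.of_forall hxΓ)

/-- A measurable selection lemma: a weakly measurable,
almost-everywhere nonempty, closed-valued multifunction into a Polish space
admits a measurable selection almost everywhere. -/
theorem stmt8 {𝒵 : Type*} [MeasurableSpace 𝒵] (P : Measure 𝒵) [IsProbabilityMeasure P]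
    {E : Type*} [TopologicalSpace E] [PolishSpace E]
    [MeasurableSpace E] [BorelSpace E]
    (Γ : 𝒵 → Set E) (hclosed : ∀ z, IsClosed (Γ z))
    (N : Set 𝒵) (hNmeas : MeasurableSet N) (hN : P N = 0)
    (hnonempty : ∀ z ∉ N, (Γ z).Nonempty)
    (hweak : ∀ U : Set E, IsOpen U → MeasurableSet {z | z ∉ N ∧ (Γ z ∩ U).Nonempty}) :
    ∃ g : 𝒵 → E, Measurable g ∧ ∀ᵐ z ∂P, g z ∈ Γ z := by
  classical
  obtain ⟨z₀, hz₀⟩ : ∃ z, z ∉ N := by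
    by_contra! h
    simp [Set.eq_univ_of_forall h] at hN
  have : Nonempty E := (hnonempty z₀ hz₀).to_type
  obtain ⟨g, hg, hgΓ⟩ := exists_measurable_selection (Γ := fun z ↦ if z ∈ N then Set.univ else Γ z)
    (fun z ↦ by
      split_ifs
      exacts [isClosed_univ, hclosed z])
    (fun z ↦ by
      split_ifs with hz
      exacts [Set.univ_nonempty, hnonempty z hz])
    (fun U hU ↦ by
      have heq : {z | ((if z ∈ N then Set.univ else Γ z) ∩ U).Nonempty} =
          (N ∩ {_z | U.Nonempty}) ∪ {z | z ∉ N ∧ (Γ z ∩ U).Nonempty} := by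
        ext z
        by_cases hz : z ∈ N <;> simp [hz]
      rw [heq]
      exact (hNmeas.inter (.const _)).union (hweak U hU))
  refine ⟨g, hg, ?_⟩
  filter_upwards [measure_eq_zero_iff_ae_notMem.1 hN] with z hz
  simpa [hz] using hgΓ z
end
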